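/- Let s be a closed line segment in ℝ², let δ > 0, and let σ_1,…,σ_N be pairwise disjoint closed segments (possibly degenerate to points) all contained in a common line L, indexed in order along L (for each j, σ_{j+1} lies strictly after σ_j along a fixed direction of L). For j = 1,…,N let η_j = (σ_j ⊕ D(0,δ)) ∩ s, where ⊕ denotes Minkowski sum and D(0,δ) is the closed disk of radius δ centered at the origin. If η_i ∩ η_j ≠ ∅ for some 1 ≤ i < j ≤ N, then η_i ∩ η_m ≠ ∅ for every m with i ≤ m ≤ j. -/

import Mathlib

open scoped Pointwise

noncomputable section

/-- The Euclidean plane. -/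
abbrev Pl : Type := EuclideanSpace ℝ (Fin 2)

/-- Consecutive ordering of nonempty intervals is an ordering of all of them. -/
theorem interval_lt_of_lt {N : ℕ} {α β : ℕ → ℝ} (hab : ∀ j, j < N → α j ≤ β j)
    (hord : ∀ j, j + 1 < N → β j < α (j + 1)) {i j : ℕ} (hij : i < j) (hj : j < N) :
    β i < α j := by
  induction j, hij using Nat.le_induction with
  | base => exact hord i hj
  | succ k _ ih =>
    exact (ih (by omega)).trans_le ((hab k (by omega)).trans (hord k hj).le)

/-- A point lies in the closed `δ`-neighborhood of a segment of a parameterized line if and only if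
it is at distance at most `δ` from a point whose parameter lies in the corresponding interval. -/
theorem mem_segment_add_closedBall_iff {E : Type*} [NormedAddCommGroup E] [NormedSpace ℝ E]
    {p e x : E} {a b δ : ℝ} (hab : a ≤ b) :
    x ∈ segment ℝ (p + a • e) (p + b • e) + Metric.closedBall (0 : E) δ ↔
      ∃ t ∈ Set.Icc a b, p + t • e ∈ Metric.closedBall x δ := by
  have himage : segment ℝ (p + a • e) (p + b • e) = (fun t : ℝ => p + t • e) '' Set.Icc a b := by
    have hline : ⇑(AffineMap.lineMap p (p + e) : ℝ →ᵃ[ℝ] E) = fun t : ℝ => p + t • e := by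
      ext t
      simp [AffineMap.lineMap_apply, add_comm]
    have h := image_segment ℝ (AffineMap.lineMap p (p + e) : ℝ →ᵃ[ℝ] E) a b
    rw [hline, segment_eq_Icc hab] at h
    exact h.symm
  rw [himage]
  constructor
  · rintro ⟨_, ⟨t, ht, rfl⟩, v, hv, rfl⟩
    exact ⟨t, ht, by simpa [dist_eq_norm] using hv⟩
  · rintro ⟨t, ht, hx⟩
    refine ⟨_, ⟨t, ht, rfl⟩, x - (p + t • e), ?_, by simp⟩
    rwa [Metric.mem_closedBall, dist_comm, dist_eq_norm, ← mem_closedBall_zero_iff] at hx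

/-- Let `σ_0, …, σ_{N-1}` be pairwise disjoint closed segments on a common line `L`
(parameterized by a point `p` and a unit direction `e`), indexed in order along `L`
(`σ_{j+1}` lies strictly after `σ_j`), let `s` be a closed segment and `δ > 0`, and let
`η_j = (σ_j ⊕ D(0,δ)) ∩ s`.  If `η_i ∩ η_j ≠ ∅` for some `i < j`, then `η_i ∩ η_m ≠ ∅`
for every `i ≤ m ≤ j`. -/
theorem stmt13 (N : ℕ) (cS dS : Pl) (sSeg : Set Pl) (hs : sSeg = segment ℝ cS dS)
    (δ : ℝ) (hδ : 0 < δ)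
    (p e : Pl) (he : ‖e‖ = 1)
    (α β : ℕ → ℝ)
    (hab : ∀ j, j < N → α j ≤ β j)
    (hord : ∀ j, j + 1 < N → β j < α (j + 1))
    (η : ℕ → Set Pl)
    (hη : ∀ j, j < N →
      η j = (segment ℝ (p + α j • e) (p + β j • e) + Metric.closedBall (0 : Pl) δ) ∩ sSeg)
    (i j m : ℕ) (hi : i ≤ m) (hm : m ≤ j) (hj : j < N)
    (hηij : (η i ∩ η j).Nonempty) :
    (η i ∩ η m).Nonempty := by
  rcases hi.eq_or_lt with rfl | him
  · simpa using hηij.left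
  rcases hm.eq_or_lt with rfl | hmj
  · exact hηij
  have hmN : m < N := hmj.trans hj
  have hiN : i < N := him.trans hmN
  obtain ⟨x, hxi, hxj⟩ := hηij
  refine ⟨x, hxi, ?_⟩
  rw [hη i hiN] at hxi
  rw [hη j hj] at hxj
  rw [hη m hmN]
  refine ⟨(mem_segment_add_closedBall_iff (hab m hmN)).2 ?_, hxi.2⟩
  obtain ⟨t, ht, htx⟩ := (mem_segment_add_closedBall_iff (hab i hiN)).1 hxi.1
  obtain ⟨u, hu, hux⟩ := (mem_segment_add_closedBall_iff (hab j hj)).1 hxj.1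
  have htm : t ≤ α m := ht.2.trans (interval_lt_of_lt hab hord him hmN).le
  have hmu : α m ≤ u :=
    (hab m hmN).trans ((interval_lt_of_lt hab hord hmj hj).le.trans hu.1)
  refine ⟨α m, ⟨le_rfl, hab m hmN⟩, ?_⟩
  have hconv : Convex ℝ ((AffineMap.lineMap p (p + e) : ℝ →ᵃ[ℝ] Pl) ⁻¹' Metric.closedBall x δ) :=
    (convex_closedBall x δ).affine_preimage _
  have hmem := hconv.ordConnected.out (x := t) (y := u)
    (by simpa [AffineMap.lineMap_apply, add_comm] using htx)
    (by simpa [AffineMap.lineMap_apply, add_comm] using hux) ⟨htm, hmu⟩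
  simpa [AffineMap.lineMap_apply, add_comm] using hmem

end
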